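/- Let 𝔡 be a finite-dimensional real Lie algebra carrying a nondegenerate symmetric bilinear form B that is invariant, i.e. B(⁅x,y⁆,z) = B(x,⁅y,z⁆) for all x,y,z ∈ 𝔡. Let 𝔤 and 𝔥 be Lie subalgebras of 𝔡 which are both isotropic for B and complementary as linear subspaces (𝔡 = 𝔤 ⊕ 𝔥 as vector spaces), and let p : 𝔡 → 𝔤 be the linear projection onto 𝔤 along 𝔥. Suppose γ : 𝔤 × 𝔤 → ℝ is an alternating bilinear form satisfying γ(p(⁅η,X⁆), Y) + γ(X, p(⁅η,Y⁆)) = 0 for all η ∈ 𝔥 and all X, Y ∈ 𝔤. Then there is a unique linear map γ♯ : 𝔤 → 𝔥 such that B(γ♯(X), Y) = γ(X,Y) for all X, Y ∈ 𝔤, and it satisfies p(⁅γ♯(X), Y⁆) = p(⁅γ♯(Y), X⁆) for all X, Y ∈ 𝔤. -/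

import Mathlib

/-- Drinfeld compatibility of the Ad-invariant cocycle `γ` with the zero
derivation: there is a unique linear map `γ♯ : 𝔤 → 𝔥` with
`B (γ♯ X) Y = γ X Y` for all `X Y ∈ 𝔤`, and it satisfies
`p ⁅γ♯ X, Y⁆ = p ⁅γ♯ Y, X⁆` for all `X Y ∈ 𝔤`. -/
theorem gamma_sharp_drinfeld_compatible
    (𝔡 : Type*) [LieRing 𝔡] [LieAlgebra ℝ 𝔡] [FiniteDimensional ℝ 𝔡]
    (B : 𝔡 →ₗ[ℝ] 𝔡 →ₗ[ℝ] ℝ)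
    (hBsymm : ∀ x y : 𝔡, B x y = B y x)
    (hBnondeg : ∀ x : 𝔡, (∀ y : 𝔡, B x y = 0) → x = 0)
    (hBinv : ∀ x y z : 𝔡, B ⁅x, y⁆ z = B x ⁅y, z⁆)
    (𝔤 𝔥 : LieSubalgebra ℝ 𝔡)
    (h𝔤iso : ∀ x ∈ 𝔤, ∀ y ∈ 𝔤, B x y = 0)
    (h𝔥iso : ∀ x ∈ 𝔥, ∀ y ∈ 𝔥, B x y = 0)
    (hcompl : IsCompl 𝔤.toSubmodule 𝔥.toSubmodule)
    (p : 𝔡 →ₗ[ℝ] 𝔤)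
    (hp𝔤 : ∀ X : 𝔤, p (X : 𝔡) = X)
    (hp𝔥 : ∀ x ∈ 𝔥, p x = 0)
    (γ : ↥𝔤 →ₗ[ℝ] ↥𝔤 →ₗ[ℝ] ℝ)
    (hγalt : ∀ X : 𝔤, γ X X = 0)
    (hγinv : ∀ η : 𝔥, ∀ X Y : 𝔤,
      γ (p ⁅(η : 𝔡), (X : 𝔡)⁆) Y + γ X (p ⁅(η : 𝔡), (Y : 𝔡)⁆) = 0) :
    (∃! γs : ↥𝔤 →ₗ[ℝ] ↥𝔥, ∀ X Y : 𝔤, B (γs X : 𝔡) (Y : 𝔡) = γ X Y) ∧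
    (∀ γs : ↥𝔤 →ₗ[ℝ] ↥𝔥, (∀ X Y : 𝔤, B (γs X : 𝔡) (Y : 𝔡) = γ X Y) →
      ∀ X Y : 𝔤, p ⁅(γs X : 𝔡), (Y : 𝔡)⁆ = p ⁅(γs Y : 𝔡), (X : 𝔡)⁆) := by
  have hsub (x : 𝔡) : x - (p x : 𝔡) ∈ 𝔥 := by
    have hx : x ∈ 𝔤.toSubmodule ⊔ 𝔥.toSubmodule := by
      rw [hcompl.sup_eq_top]
      exact Submodule.mem_top
    obtain ⟨a, ha, b, hb, rfl⟩ := Submodule.mem_sup.mp hx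
    have hpa : p a = ⟨a, ha⟩ := hp𝔤 ⟨a, ha⟩
    simpa [map_add, hpa, hp𝔥 b hb] using hb
  have hBp (x : 𝔡) (η : 𝔥) : B (p x : 𝔡) η = B x η := by
    have h := h𝔥iso _ (hsub x) η η.2
    rw [map_sub, LinearMap.sub_apply] at h
    linarith
  have hBp' (η : 𝔥) (x : 𝔡) : B (η : 𝔡) (p x : 𝔡) = B η x := by
    rw [hBsymm, hBp, hBsymm]
  have heq_h (a b : 𝔥) (h : ∀ Y : 𝔤, B (a : 𝔡) (Y : 𝔡) = B (b : 𝔡) (Y : 𝔡)) : a = b := by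
    apply Subtype.ext
    rw [← sub_eq_zero]
    apply hBnondeg
    intro y
    rw [map_sub, LinearMap.sub_apply, ← hBp' a y, ← hBp' b y, h, sub_self]
  have heq_g (a b : 𝔤) (h : ∀ η : 𝔥, B (a : 𝔡) (η : 𝔡) = B (b : 𝔡) (η : 𝔡)) : a = b := by
    apply Subtype.ext
    rw [← sub_eq_zero]
    apply hBnondeg
    intro y
    have hg := h𝔤iso _ (𝔤.sub_mem a.2 b.2) (p y) (p y).2
    have hh : B ((a : 𝔡) - b) (y - (p y : 𝔡)) = 0 := by
      rw [LinearMap.map_sub₂]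
      exact sub_eq_zero.mpr (h ⟨_, hsub y⟩)
    rw [map_sub, hg, sub_zero] at hh
    exact hh
  have hγskew (X Y : 𝔤) : γ X Y = -γ Y X := by
    have h := hγalt (X + Y)
    simp only [map_add, LinearMap.add_apply, hγalt] at h
    linarith
  refine ⟨?_, ?_⟩
  · have hinj : Function.Injective B := by
      rw [injective_iff_map_eq_zero]
      intro x hx
      exact hBnondeg x fun y => by rw [hx, LinearMap.zero_apply]
    let T : 𝔡 ≃ₗ[ℝ] Module.Dual ℝ 𝔡 :=
      LinearEquiv.ofInjectiveOfFinrankEq B hinj Subspace.dual_finrank_eq.symm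
    have hT (φ : Module.Dual ℝ 𝔡) : B (T.symm φ) = φ := T.apply_symm_apply φ
    let π : 𝔡 →ₗ[ℝ] 𝔥 :=
      LinearMap.codRestrict 𝔥.toSubmodule (LinearMap.id - 𝔤.toSubmodule.subtype ∘ₗ p) hsub
    have hπ (x : 𝔡) : (π x : 𝔡) = x - (p x : 𝔡) := rfl
    let γs : 𝔤 →ₗ[ℝ] 𝔥 := π ∘ₗ T.symm.toLinearMap ∘ₗ p.dualMap ∘ₗ γ
    have hγs (X Y : 𝔤) : B (γs X : 𝔡) (Y : 𝔡) = γ X Y := by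
      change B (π (T.symm (p.dualMap (γ X))) : 𝔡) (Y : 𝔡) = γ X Y
      rw [hπ, map_sub, LinearMap.sub_apply, hT, h𝔤iso _ (p _).2 _ Y.2, sub_zero,
        LinearMap.dualMap_apply, hp𝔤]
    refine ⟨γs, hγs, fun δ hδ => LinearMap.ext fun X => heq_h _ _ fun Y => ?_⟩
    rw [hδ, hγs]
  · intro γs hγs X Y
    have key (X Y : 𝔤) (η : 𝔥) :
        B (p ⁅(γs X : 𝔡), (Y : 𝔡)⁆ : 𝔡) η = -γ X (p ⁅(η : 𝔡), (Y : 𝔡)⁆) := by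
      rw [hBp, hBinv, ← lie_skew, map_neg, ← hBp', hγs]
    apply heq_g
    intro η
    rw [key, key]
    linarith [hγinv η X Y, hγskew Y (p ⁅(η : 𝔡), (X : 𝔡)⁆)]
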